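/- Let s ∈ ℂ with Re(s) > −1/2 and for N ≥ 1 define P̃_N(x) = 2^{Re(s)} (Γ(2Re(s)+N+1)/(N·Γ(N)))^{1/2} · p̃_N(Nx) · √(w_H(Nx)) and Q_N(x) = 2^{Re(s)+1} (N·Γ(2Re(s)+N+1)/Γ(N))^{1/2} · p_{N−1}(Nx) · √(w_H(Nx)). Then for every x₀ > 0 there exists a constant C(x₀,s) such that for all N ≥ 1, all p ∈ {0,1} and all x > x₀: |P̃_N^{(p)}(x) − P̃^{(p)}(x)| ≤ (1/N) · C(x₀,s)/x^{p+Re(s)} and |Q_N^{(p)}(x) − Q^{(p)}(x)| ≤ (1/N) · C(x₀,s)/x^{p+1+Re(s)}. -/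

import Mathlib

noncomputable section

open Complex MeasureTheory Filter Set

/-- Rising Pochhammer symbol `(x)_n = x(x+1)⋯(x+n−1)`. -/
def poch (x : ℂ) (n : ℕ) : ℂ := ∏ i ∈ Finset.range n, (x + i)

/-- Confluent hypergeometric series `₁F₁[r, q; z]`. -/
def oneF1 (r q z : ℂ) : ℂ := ∑' n : ℕ, poch r n / (poch q n * n.factorial) * z ^ n

/-- Terminating Gauss hypergeometric series `₂F₁[−m, b, c; z]`. -/
def twoF1neg (m : ℕ) (b c z : ℂ) : ℂ :=
  ∑ k ∈ Finset.range (m + 1),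
    poch (-(m : ℂ)) k * poch b k / (poch c k * (k.factorial : ℂ)) * z ^ k

/-- The common prefactor `|2/x|^{Re s} e^{−i/x + π Im(s) Sgn(x)/2}`. -/
def prefac (s : ℂ) (x : ℝ) : ℂ :=
  ((|2 / x| ^ s.re : ℝ) : ℂ) *
    Complex.exp (-Complex.I / (x : ℂ) + ((Real.pi * s.im * Real.sign x / 2 : ℝ) : ℂ))

/-- `P̃(x) = |2/x|^{Re s} e^{−i/x + π Im(s) Sgn(x)/2} ₁F₁[s, 2Re(s)+1; 2i/x]`. -/
def Ptilde (s : ℂ) (x : ℝ) : ℂ :=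
  prefac s x * oneF1 s ((2 * s.re + 1 : ℝ) : ℂ) (2 * Complex.I / (x : ℂ))

/-- `Q(x) = (2/x)|2/x|^{Re s} e^{−i/x + π Im(s) Sgn(x)/2} ₁F₁[s+1, 2Re(s)+2; 2i/x]`. -/
def Qfun (s : ℂ) (x : ℝ) : ℂ :=
  (2 / (x : ℂ)) * prefac s x * oneF1 (s + 1) ((2 * s.re + 2 : ℝ) : ℂ) (2 * Complex.I / (x : ℂ))

/-- The constant in front of the limiting kernel `K_∞`. -/
def cinf (s : ℂ) : ℂ :=
  (1 / (2 * (Real.pi : ℂ))) *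
    (Complex.Gamma (s + 1) * Complex.Gamma ((starRingEnd ℂ) s + 1) /
      (Complex.Gamma ((2 * s.re + 1 : ℝ) : ℂ) * Complex.Gamma ((2 * s.re + 2 : ℝ) : ℂ)))

/-- The limiting kernel `K_∞`, as a complex number (it is in fact real). -/
def KinfC (s : ℂ) (x y : ℝ) : ℂ :=
  if x = y then cinf s * (deriv (Ptilde s) x * Qfun s x - deriv (Qfun s) x * Ptilde s x)
  else cinf s * (Ptilde s x * Qfun s y - Qfun s x * Ptilde s y) / ((x : ℂ) - (y : ℂ))

/-- The limiting kernel `K_∞` (real-valued). -/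
def Kinf (s : ℂ) (x y : ℝ) : ℝ := (KinfC s x y).re

/-- The generalized Cauchy weight `w_H` on `ℝ`. -/
def wH (s : ℂ) (N : ℕ) (x : ℝ) : ℝ :=
  (1 + x ^ 2) ^ (-s.re - (N : ℝ)) * Real.exp (2 * s.im * Complex.arg (1 + Complex.I * x))

/-- The polynomial `p_{N−1}`. -/
def pPrev (s : ℂ) (N : ℕ) (x : ℝ) : ℂ :=
  ((x : ℂ) - Complex.I) ^ (N - 1) *
    twoF1neg (N - 1) (s + 1) ((2 * s.re + 2 : ℝ) : ℂ) (2 / (1 + Complex.I * (x : ℂ)))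

/-- The polynomial `p̃_N`. -/
def pTil (s : ℂ) (N : ℕ) (x : ℝ) : ℂ :=
  ((x : ℂ) - Complex.I) ^ N *
    twoF1neg N s ((2 * s.re + 1 : ℝ) : ℂ) (2 / (1 + Complex.I * (x : ℂ)))

/-- The constant `C_{N,s}`. -/
def CNs (s : ℂ) (N : ℕ) : ℂ :=
  (((2 : ℝ) ^ (2 * s.re) / Real.pi : ℝ) : ℂ) *
    (Complex.Gamma ((2 * s.re + N + 1 : ℝ) : ℂ) * Complex.Gamma (s + 1) *
        Complex.Gamma ((starRingEnd ℂ) s + 1) /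
      (Complex.Gamma (N : ℂ) * Complex.Gamma ((2 * s.re + 1 : ℝ) : ℂ) *
        Complex.Gamma ((2 * s.re + 2 : ℝ) : ℂ)))

def phiN (s : ℂ) (N : ℕ) (x : ℝ) : ℂ := pTil s N x * (Real.sqrt (wH s N x) : ℂ)

def psiN (s : ℂ) (N : ℕ) (x : ℝ) : ℂ := pPrev s N x * (Real.sqrt (wH s N x) : ℂ)

/-- The finite-`N` kernel `K_N` (complex form; extended to the diagonal by continuity,
i.e. by the Bernoulli–l'Hôpital expression). -/
def KNC (s : ℂ) (N : ℕ) (x y : ℝ) : ℂ :=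
  if x = y then CNs s N * (deriv (phiN s N) x * psiN s N x - deriv (psiN s N) x * phiN s N x)
  else CNs s N * (phiN s N x * psiN s N y - psiN s N x * phiN s N y) / ((x : ℂ) - (y : ℂ))

/-- The finite-`N` kernel `K_N` (real-valued). -/
def KN (s : ℂ) (N : ℕ) (x y : ℝ) : ℝ := (KNC s N x y).re

/-- The rescaled kernel `K_[N](x,y) = N · K_N(Nx, Ny)`. -/
def Kscaled (s : ℂ) (N : ℕ) (x y : ℝ) : ℝ := N * KN s N (N * x) (N * y)

/-- `P̃_N`. -/
def PtildeN (s : ℂ) (N : ℕ) (x : ℝ) : ℂ :=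
  (((2 : ℝ) ^ s.re : ℝ) : ℂ) *
    (Real.sqrt (Real.Gamma (2 * s.re + N + 1) / (N * Real.Gamma N)) : ℂ) *
    pTil s N (N * x) * (Real.sqrt (wH s N (N * x)) : ℂ)

/-- `Q_N`. -/
def QN (s : ℂ) (N : ℕ) (x : ℝ) : ℂ :=
  (((2 : ℝ) ^ (s.re + 1) : ℝ) : ℂ) *
    (Real.sqrt (N * Real.Gamma (2 * s.re + N + 1) / Real.Gamma N) : ℂ) *
    pPrev s N (N * x) * (Real.sqrt (wH s N (N * x)) : ℂ)

/-- `k`-point correlation function of a kernel. -/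
def rhoK (K : ℝ → ℝ → ℝ) (k : ℕ) (x : Fin k → ℝ) : ℝ :=
  Matrix.det (Matrix.of fun i j => K (x i) (x j))

/-- The Fredholm determinant of a kernel restricted to `(t,∞)²`. -/
def fredholmDet (K : ℝ → ℝ → ℝ) (t : ℝ) : ℝ :=
  1 + ∑' k : ℕ, ((-1 : ℝ) ^ (k + 1) / (k + 1).factorial) *
    ∫ x : Fin (k + 1) → ℝ in Set.univ.pi fun _ => Set.Ioi t, rhoK K (k + 1) x

/-- Mixed partial derivative `∂^{p+q}K/∂x^p∂y^q`. -/
def pderiv₂ (K : ℝ → ℝ → ℝ) (p q : ℕ) (x y : ℝ) : ℝ :=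
  iteratedDeriv p (fun x' => iteratedDeriv q (fun y' => K x' y') y) x

/-- `F_{n,h,a}(x) = ₂F₁[−n, h, a; 2/(1+ix)]` (a terminating series). -/
def Fnha (n : ℕ) (h : ℂ) (a : ℝ) (x : ℝ) : ℂ :=
  ∑' k : ℕ, poch (-(n : ℂ)) k * poch h k / (poch (a : ℂ) k * (k.factorial : ℂ)) *
    (2 / (1 + Complex.I * (x : ℂ))) ^ k

/-- `θ(τ) = τ (d/dτ) log F(τ⁻¹)`. -/
def thetaOf (F : ℝ → ℝ) (τ : ℝ) : ℝ := τ * deriv (fun u => Real.log (F u⁻¹)) τ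

/-- Squared Vandermonde determinant `∏_{j<k} (x_j − x_k)²`. -/
def vandSq (N : ℕ) (x : Fin N → ℝ) : ℝ :=
  ∏ p ∈ Finset.univ.filter fun p : Fin N × Fin N => p.1 < p.2, (x p.1 - x p.2) ^ 2

/-- `φ(x,y) = (f(x)g(y) − g(x)f(y))/(x−y)`, extended to the diagonal. -/
def phiFG (f g : ℝ → ℝ) (x y : ℝ) : ℝ :=
  if x = y then deriv f x * g x - deriv g x * f x else (f x * g y - g x * f y) / (x - y)


/-! ### Uniform convergence at rate `1 / N` -/

/-- `f N` converges to the bounded function `g` uniformly on `D` at rate `1 / N`. -/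
def UnifRate (D : Set ℂ) (f : ℕ → ℂ → ℂ) (g : ℂ → ℂ) : Prop :=
  (∃ M : ℝ, ∀ t ∈ D, ‖g t‖ ≤ M) ∧
    ∃ C : ℝ, ∀ N : ℕ, 1 ≤ N → ∀ t ∈ D, ‖f N t - g t‖ ≤ C / N

lemma UnifRate.mul {D : Set ℂ} {f₁ f₂ : ℕ → ℂ → ℂ} {g₁ g₂ : ℂ → ℂ}
    (h₁ : UnifRate D f₁ g₁) (h₂ : UnifRate D f₂ g₂) :
    UnifRate D (fun N t => f₁ N t * f₂ N t) (fun t => g₁ t * g₂ t) := by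
  obtain ⟨⟨M₁, hM₁⟩, C₁, hC₁⟩ := h₁
  obtain ⟨⟨M₂, hM₂⟩, C₂, hC₂⟩ := h₂
  refine ⟨⟨M₁ * M₂, fun t ht => ?_⟩, C₁ * (|M₂| + |C₂|) + M₁ * C₂, fun N hN t ht => ?_⟩
  · rw [norm_mul]
    exact mul_le_mul (hM₁ t ht) (hM₂ t ht) (norm_nonneg _) ((norm_nonneg _).trans (hM₁ t ht))
  · have hN' : (1 : ℝ) ≤ N := by exact_mod_cast hN
    have e₁ := hC₁ N hN t ht
    have e₂ := hC₂ N hN t ht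
    have hf₂ : ‖f₂ N t‖ ≤ |M₂| + |C₂| := by
      calc ‖f₂ N t‖ = ‖g₂ t + (f₂ N t - g₂ t)‖ := by ring_nf
        _ ≤ ‖g₂ t‖ + ‖f₂ N t - g₂ t‖ := norm_add_le _ _
        _ ≤ |M₂| + |C₂| := by
          refine add_le_add ((hM₂ t ht).trans (le_abs_self _)) (e₂.trans ?_)
          rw [div_le_iff₀ (by positivity)]
          exact (le_abs_self _).trans (le_mul_of_one_le_right (abs_nonneg _) hN')
    calc ‖f₁ N t * f₂ N t - g₁ t * g₂ t‖
        = ‖(f₁ N t - g₁ t) * f₂ N t + g₁ t * (f₂ N t - g₂ t)‖ := by ring_nf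
      _ ≤ ‖f₁ N t - g₁ t‖ * ‖f₂ N t‖ + ‖g₁ t‖ * ‖f₂ N t - g₂ t‖ :=
          (norm_add_le _ _).trans (by rw [norm_mul, norm_mul])
      _ ≤ C₁ / N * (|M₂| + |C₂|) + M₁ * (C₂ / N) :=
          add_le_add
            (mul_le_mul e₁ hf₂ (norm_nonneg _) ((norm_nonneg _).trans e₁))
            (mul_le_mul (hM₁ t ht) e₂ (norm_nonneg _) ((norm_nonneg _).trans (hM₁ t ht)))
      _ = (C₁ * (|M₂| + |C₂|) + M₁ * C₂) / N := by ring

lemma UnifRate.const (D : Set ℂ) {c : ℕ → ℂ} {l : ℂ} {C : ℝ}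
    (h : ∀ N : ℕ, 1 ≤ N → ‖c N - l‖ ≤ C / N) :
    UnifRate D (fun N _ => c N) (fun _ => l) :=
  ⟨⟨‖l‖, fun _ _ => le_rfl⟩, C, fun N hN _ _ => h N hN⟩

lemma UnifRate.exp {D : Set ℂ} {f : ℕ → ℂ → ℂ} {g : ℂ → ℂ} (h : UnifRate D f g) :
    UnifRate D (fun N t => Complex.exp (f N t)) (fun t => Complex.exp (g t)) := by
  obtain ⟨⟨M, hM⟩, C, hC⟩ := h
  have hexp : ∀ t ∈ D, ‖Complex.exp (g t)‖ ≤ Real.exp M := fun t ht => by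
    rw [Complex.norm_exp]
    exact Real.exp_le_exp.2 ((Complex.re_le_norm _).trans (hM t ht))
  refine ⟨⟨Real.exp M, hexp⟩, Real.exp M * (C * Real.exp |C|), fun N hN t ht => ?_⟩
  have hN' : (1 : ℝ) ≤ N := by exact_mod_cast hN
  have e := hC N hN t ht
  have hd : ‖Complex.exp (f N t - g t) - 1‖ ≤ C / N * Real.exp |C| := by
    have h1 := Complex.norm_exp_sub_sum_le_norm_mul_exp (f N t - g t) 1
    simp only [Finset.sum_range_one, pow_zero, Nat.factorial_zero, Nat.cast_one, div_one,
      pow_one] at h1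
    refine h1.trans (mul_le_mul e (Real.exp_le_exp.2 (e.trans ?_)) (Real.exp_pos _).le
      ((norm_nonneg _).trans e))
    rw [div_le_iff₀ (by positivity)]
    exact (le_abs_self _).trans (le_mul_of_one_le_right (abs_nonneg _) hN')
  calc ‖Complex.exp (f N t) - Complex.exp (g t)‖
      = ‖Complex.exp (g t) * (Complex.exp (f N t - g t) - 1)‖ := by
        rw [mul_sub, ← Complex.exp_add]; ring_nf
    _ ≤ Real.exp M * (C / N * Real.exp |C|) := by
        rw [norm_mul]
        exact mul_le_mul (hexp t ht) hd (norm_nonneg _) (Real.exp_pos _).le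
    _ = _ := by ring

/-! ### The domain in the variable `t = 1 / x` -/

/-- The part of the strip `|Im t| ≤ 1/2` in the closed disc of radius `R`. -/
def strip (R : ℝ) : Set ℂ := {t | |t.im| ≤ 1 / 2 ∧ ‖t‖ ≤ R}

lemma abs_re_I_mul_div_le {R : ℝ} {t : ℂ} (ht : t ∈ strip R) {N : ℕ} (hN : 1 ≤ N) :
    |(I * (t / N)).re| ≤ 1 / 2 := by
  have hN' : (1 : ℝ) ≤ N := by exact_mod_cast hN
  have : (I * (t / N)).re = -(t.im / N) := by
    simp [Complex.div_natCast_im]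
  rw [this, abs_neg, abs_div, Nat.abs_cast]
  exact (div_le_self (abs_nonneg _) hN').trans ht.1

lemma norm_I_mul_div_le {R : ℝ} {t : ℂ} (ht : t ∈ strip R) (N : ℕ) :
    ‖I * (t / N)‖ ≤ R / N := by
  rw [norm_mul, norm_I, one_mul, norm_div, Complex.norm_natCast]
  exact div_le_div_of_nonneg_right ht.2 (Nat.cast_nonneg _)

lemma half_le_norm_one_sub {v : ℂ} (hv : |v.re| ≤ 1 / 2) : 1 / 2 ≤ ‖1 - v‖ := by
  refine le_trans ?_ (Complex.re_le_norm _)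
  have := (abs_le.1 hv).2
  simp only [sub_re, one_re]
  linarith

lemma one_sub_mem_slitPlane {v : ℂ} (hv : |v.re| ≤ 1 / 2) : 1 - v ∈ slitPlane := by
  left
  have := (abs_le.1 hv).2
  simp only [sub_re, one_re]
  linarith

lemma one_sub_ne_zero {v : ℂ} (hv : |v.re| ≤ 1 / 2) : 1 - v ≠ 0 :=
  slitPlane_ne_zero (one_sub_mem_slitPlane hv)

lemma norm_log_one_sub_add_le {v : ℂ} (hv : |v.re| ≤ 1 / 2) :
    ‖Complex.log (1 - v) + v‖ ≤ 2 * ‖v‖ ^ 2 := by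
  let S : Set ℂ := {z | |z.re| ≤ 1 / 2} ∩ Metric.closedBall 0 ‖v‖
  have hS : Convex ℝ S := by
    refine Convex.inter ?_ (convex_closedBall _ _)
    have : {z : ℂ | |z.re| ≤ 1 / 2} = Complex.reLm ⁻¹' Set.Icc (-(1 / 2)) (1 / 2) := by
      ext z; simp [abs_le]
    rw [this]
    exact (convex_Icc _ _).linear_preimage _
  have hder : ∀ z ∈ S, HasDerivWithinAt (fun z => Complex.log (1 - z) + z) (-z / (1 - z)) S z := by
    intro z hz
    have h0 := one_sub_ne_zero hz.1
    have h1 : HasDerivAt (fun z : ℂ => 1 - z) (-1) z := by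
      simpa using (hasDerivAt_id z).const_sub 1
    have h2 := (h1.clog (one_sub_mem_slitPlane hz.1)).add (hasDerivAt_id z)
    refine (h2.congr_deriv ?_).hasDerivWithinAt
    field_simp
    ring
  have hbd : ∀ z ∈ S, ‖-z / (1 - z)‖ ≤ 2 * ‖v‖ := by
    intro z hz
    have h0 := half_le_norm_one_sub hz.1
    have h1 : ‖z‖ ≤ ‖v‖ := by simpa using hz.2
    rw [norm_div, norm_neg, div_le_iff₀ (by linarith)]
    nlinarith [norm_nonneg v]
  have := hS.norm_image_sub_le_of_norm_hasDerivWithin_le hder hbd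
    (x := 0) (y := v) ⟨by simp, by simp⟩ ⟨hv, by simp⟩
  simp only [sub_zero, Complex.log_one, add_zero] at this
  linarith

/-! ### The exponent of the prefactor -/

/-- The exponent `((N - s) log(1 - it/N) - (N + s̄) log(1 + it/N)) / 2`. -/
def expoN (s : ℂ) (N : ℕ) (t : ℂ) : ℂ :=
  ((N - s) * Complex.log (1 - I * (t / N)) -
    (N + (starRingEnd ℂ) s) * Complex.log (1 - -(I * (t / N)))) / 2

lemma unifRate_expoN (s : ℂ) (R : ℝ) :
    UnifRate (strip R) (expoN s) (fun t => -(I * t)) := by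
  refine ⟨⟨R, fun t ht => by simpa using ht.2⟩, ‖s‖ * R + 2 * (1 + ‖s‖) * R ^ 2,
    fun N hN t ht => ?_⟩
  have hN' : (1 : ℝ) ≤ N := by exact_mod_cast hN
  have hN0 : (N : ℂ) ≠ 0 := by exact_mod_cast (by omega : N ≠ 0)
  have hre := abs_re_I_mul_div_le ht hN
  have hv := norm_I_mul_div_le ht N
  have hIt : I * t = N * (I * (t / N)) := by field_simp
  have hR : 0 ≤ R := (norm_nonneg _).trans ht.2
  unfold expoN
  beta_reduce
  rw [hIt]
  generalize I * (t / N) = v at *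
  have e₁ := norm_log_one_sub_add_le hre
  have e₂ := norm_log_one_sub_add_le (v := -v) (by simpa using hre)
  rw [norm_neg] at e₂
  set l₁ := Complex.log (1 - v) + v with hl₁
  set l₂ := Complex.log (1 - -v) + -v with hl₂
  have key : ((N - s) * Complex.log (1 - v) -
      (N + (starRingEnd ℂ) s) * Complex.log (1 - -v)) / 2 - -(N * v)
      = ((s - (starRingEnd ℂ) s) * v + (N - s) * l₁ - (N + (starRingEnd ℂ) s) * l₂) / 2 := by
    rw [hl₁, hl₂]; ring
  have hs : ‖(starRingEnd ℂ) s‖ = ‖s‖ := RCLike.norm_conj s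
  have hNs₁ : ‖(N : ℂ) - s‖ ≤ N + ‖s‖ := (norm_sub_le _ _).trans (by simp)
  have hNs₂ : ‖(N : ℂ) + (starRingEnd ℂ) s‖ ≤ N + ‖s‖ := (norm_add_le _ _).trans (by simp)
  have hss : ‖s - (starRingEnd ℂ) s‖ ≤ 2 * ‖s‖ :=
    (norm_sub_le _ _).trans (by rw [hs]; linarith)
  have hsq : ‖v‖ ^ 2 ≤ (R / N) ^ 2 := pow_le_pow_left₀ (norm_nonneg _) hv 2
  rw [key, norm_div, Complex.norm_ofNat]
  have b₁ : ‖(s - (starRingEnd ℂ) s) * v‖ ≤ 2 * ‖s‖ * (R / N) := by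
    rw [norm_mul]; gcongr
  have b₂ : ‖(N - s) * l₁‖ ≤ (N + ‖s‖) * (2 * (R / N) ^ 2) := by
    rw [norm_mul]; gcongr; linarith
  have b₃ : ‖(N + (starRingEnd ℂ) s) * l₂‖ ≤ (N + ‖s‖) * (2 * (R / N) ^ 2) := by
    rw [norm_mul]; gcongr; linarith
  have b₄ : (N + ‖s‖) * (2 * (R / N) ^ 2) ≤ 2 * (1 + ‖s‖) * R ^ 2 / N := by
    have : N + ‖s‖ ≤ N * (1 + ‖s‖) := by nlinarith [norm_nonneg s]
    calc (N + ‖s‖) * (2 * (R / N) ^ 2) ≤ (N * (1 + ‖s‖)) * (2 * (R / N) ^ 2) := by gcongr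
      _ = 2 * (1 + ‖s‖) * R ^ 2 / N := by field_simp
  have b₅ := (norm_sub_le ((s - (starRingEnd ℂ) s) * v + (N - s) * l₁)
    ((N + (starRingEnd ℂ) s) * l₂)).trans <| add_le_add (norm_add_le _ _) le_rfl
  calc _ ≤ (2 * ‖s‖ * (R / N) + 2 * (1 + ‖s‖) * R ^ 2 / N + 2 * (1 + ‖s‖) * R ^ 2 / N) / 2 := by
        gcongr; linarith
    _ = _ := by ring

lemma unifRate_inv_one_sub (R : ℝ) :
    UnifRate (strip R) (fun N t => (1 - I * (t / N))⁻¹) (fun _ => 1) := by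
  refine ⟨⟨1, fun t _ => by simp⟩, 2 * R, fun N hN t ht => ?_⟩
  have hre := abs_re_I_mul_div_le ht hN
  have hv := norm_I_mul_div_le ht N
  beta_reduce
  generalize I * (t / N) = v at *
  have h0 := one_sub_ne_zero hre
  have h1 := half_le_norm_one_sub hre
  have : (1 - v)⁻¹ - 1 = v / (1 - v) := by field_simp; ring
  rw [this, norm_div, div_le_iff₀ (by linarith), mul_div_assoc]
  nlinarith [norm_nonneg v]

/-! ### The hypergeometric factor -/

/-- The argument `2it / (1 - it/N)` of the rescaled terminating series. -/
def argN (N : ℕ) (t : ℂ) : ℂ := 2 * I * t / (1 - I * (t / N))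

lemma norm_argN_le {R : ℝ} {t : ℂ} (ht : t ∈ strip R) {N : ℕ} (hN : 1 ≤ N) :
    ‖argN N t‖ ≤ 4 * R := by
  have h1 := half_le_norm_one_sub (abs_re_I_mul_div_le ht hN)
  have := ht.2
  unfold argN
  rw [norm_div, div_le_iff₀ (by linarith)]
  simp only [norm_mul, Complex.norm_ofNat, norm_I, mul_one]
  nlinarith [norm_nonneg t]

lemma norm_argN_sub_le {R : ℝ} {t : ℂ} (ht : t ∈ strip R) {N : ℕ} (hN : 1 ≤ N) :
    ‖argN N t - 2 * I * t‖ ≤ 4 * R ^ 2 / N := by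
  have hre := abs_re_I_mul_div_le ht hN
  have hv := norm_I_mul_div_le ht N
  have ht2 := ht.2
  have hR : 0 ≤ R := (norm_nonneg _).trans ht.2
  have e : 4 * R ^ 2 / N = (4 * R) * (R / N) := by ring
  have key : argN N t - 2 * I * t = argN N t * (I * (t / N)) := by
    unfold argN
    have := one_sub_ne_zero hre
    generalize I * (t / N) = v at *
    field_simp
    ring
  rw [key, e, norm_mul]
  gcongr
  exact norm_argN_le ht hN

lemma norm_pow_sub_pow_le_mul {a b : ℂ} {W : ℝ} (hW : 1 ≤ W) (ha : ‖a‖ ≤ W) (hb : ‖b‖ ≤ W)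
    (k : ℕ) : ‖a ^ k - b ^ k‖ ≤ k * W ^ k * ‖a - b‖ := by
  induction k with
  | zero => simp
  | succ k ih =>
    have h1 : ‖a ^ k‖ ≤ W ^ (k + 1) := by
      rw [norm_pow]
      exact (pow_le_pow_left₀ (norm_nonneg _) ha k).trans (pow_le_pow_right₀ hW (by omega))
    calc ‖a ^ (k + 1) - b ^ (k + 1)‖ = ‖(a ^ k - b ^ k) * b + a ^ k * (a - b)‖ := by ring_nf
      _ ≤ ‖a ^ k - b ^ k‖ * ‖b‖ + ‖a ^ k‖ * ‖a - b‖ :=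
          (norm_add_le _ _).trans (by rw [norm_mul, norm_mul])
      _ ≤ (k * W ^ k * ‖a - b‖) * W + W ^ (k + 1) * ‖a - b‖ := by gcongr
      _ = _ := by push_cast; ring

/-- The coefficient of `z ^ k` in `₁F₁[b, c; z]`. -/
def hyperCoeff (b : ℂ) (c : ℝ) (k : ℕ) : ℂ := poch b k / (poch (c : ℂ) k * k.factorial)

lemma poch_succ (x : ℂ) (k : ℕ) : poch x (k + 1) = poch x k * (x + k) :=
  Finset.prod_range_succ _ _

lemma norm_hyperCoeff_le (b : ℂ) {c : ℝ} (hc : 0 < c) (k : ℕ) :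
    ‖hyperCoeff b c k‖ ≤ (‖b‖ / c + 1) ^ k / k.factorial := by
  induction k with
  | zero => simp [hyperCoeff, poch]
  | succ k ih =>
    have hck : ‖(c : ℂ) + k‖ = c + k := by
      rw [← Complex.ofReal_natCast, ← Complex.ofReal_add, Complex.norm_real, Real.norm_eq_abs,
        abs_of_nonneg (by positivity)]
    have hstep : hyperCoeff b c (k + 1) = hyperCoeff b c k * ((b + k) / (c + k)) / (k + 1 : ℕ) := by
      unfold hyperCoeff
      rw [poch_succ, poch_succ, Nat.factorial_succ, Nat.cast_mul, div_mul_div_comm, div_div]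
      congr 1
      ring
    have hratio : ‖(b + k) / ((c : ℂ) + k)‖ ≤ ‖b‖ / c + 1 := by
      rw [norm_div, hck, div_le_iff₀ (by positivity)]
      refine (norm_add_le _ _).trans ?_
      rw [Complex.norm_natCast]
      have h1 : 0 ≤ ‖b‖ / c * k := by positivity
      have h2 : ‖b‖ / c * c = ‖b‖ := by field_simp
      nlinarith
    rw [hstep, norm_div, norm_mul, Complex.norm_natCast, Nat.factorial_succ, Nat.cast_mul]
    calc ‖hyperCoeff b c k‖ * ‖(b + k) / ((c : ℂ) + k)‖ / (k + 1 : ℕ)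
        ≤ ((‖b‖ / c + 1) ^ k / k.factorial) * (‖b‖ / c + 1) / (k + 1 : ℕ) := by gcongr
      _ = _ := by rw [pow_succ]; field_simp

/-- The normalised product `m (m - 1) ⋯ (m - k + 1) / N ^ k`. -/
def fallingRatio (m N k : ℕ) : ℝ := ∏ j ∈ Finset.range k, ((m : ℝ) - j) / N

lemma fallingRatio_eq_zero {m N k : ℕ} (h : m < k) : fallingRatio m N k = 0 :=
  Finset.prod_eq_zero (Finset.mem_range.2 h) (by simp)

lemma fallingRatio_bounds {m N : ℕ} (hN : 1 ≤ N) (hm : m ≤ N) (hm' : N ≤ m + 1) (k : ℕ) :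
    0 ≤ fallingRatio m N k ∧ fallingRatio m N k ≤ 1 ∧
      1 - (k : ℝ) ^ 2 / N ≤ fallingRatio m N k := by
  have hN' : (1 : ℝ) ≤ N := by exact_mod_cast hN
  have hmR : (m : ℝ) ≤ N := by exact_mod_cast hm
  have hmR' : (N : ℝ) ≤ m + 1 := by exact_mod_cast hm'
  induction k with
  | zero => simp [fallingRatio]
  | succ k ih =>
    obtain ⟨h0, h1, h2⟩ := ih
    rcases Nat.lt_or_ge m (k + 1) with h | h
    · rw [fallingRatio_eq_zero h]
      refine ⟨le_rfl, zero_le_one, ?_⟩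
      have : (m : ℝ) + 1 ≤ k + 1 := by exact_mod_cast h
      rw [sub_nonpos, le_div_iff₀ (by positivity)]
      push_cast
      nlinarith
    · have hk : (k : ℝ) + 1 ≤ m := by exact_mod_cast h
      have hstep : fallingRatio m N (k + 1) = fallingRatio m N k * (((m : ℝ) - k) / N) :=
        Finset.prod_range_succ _ _
      have f0 : 0 ≤ ((m : ℝ) - k) / N := div_nonneg (by linarith) (by linarith)
      have f1 : ((m : ℝ) - k) / N ≤ 1 := by
        rw [div_le_one (by positivity)]
        have : (0 : ℝ) ≤ k := Nat.cast_nonneg k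
        linarith
      have f2 : 1 - ((k : ℝ) + 1) / N ≤ ((m : ℝ) - k) / N := by
        rw [sub_le_iff_le_add, ← add_div, le_div_iff₀ (by positivity)]
        linarith
      have f3 : ((k + 1 : ℕ) : ℝ) ^ 2 / N = (k : ℝ) ^ 2 / N + ((k : ℝ) + 1) / N + k / N := by
        push_cast; ring
      have f4 : 0 ≤ (k : ℝ) / N := by positivity
      rw [hstep, f3]
      refine ⟨mul_nonneg h0 f0, mul_le_one₀ h1 f0 f1, ?_⟩
      nlinarith [mul_nonneg h0 f0, mul_nonneg (sub_nonneg.2 h1) (sub_nonneg.2 f1)]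

lemma poch_neg_mul_pow (m N k : ℕ) (w : ℂ) :
    poch (-(m : ℂ)) k * (-(w / N)) ^ k = fallingRatio m N k * w ^ k := by
  induction k with
  | zero => simp [poch, fallingRatio]
  | succ k ih =>
    have hstep : fallingRatio m N (k + 1) = fallingRatio m N k * (((m : ℝ) - k) / N) :=
      Finset.prod_range_succ _ _
    rw [poch_succ, hstep, pow_succ, pow_succ]
    push_cast
    calc _ = (poch (-(m : ℂ)) k * (-(w / N)) ^ k) * ((-(m : ℂ) + k) * (-(w / N))) := by ring
      _ = _ := by rw [ih]; ring

lemma twoF1neg_eq_tsum (m N : ℕ) (b : ℂ) (c : ℝ) (w : ℂ) :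
    twoF1neg m b c (-(w / N)) = ∑' k, hyperCoeff b c k * (fallingRatio m N k * w ^ k) := by
  unfold twoF1neg
  rw [tsum_eq_sum (s := Finset.range (m + 1))]
  · refine Finset.sum_congr rfl fun k _ => ?_
    rw [← poch_neg_mul_pow, hyperCoeff]
    ring
  · intro k hk
    rw [fallingRatio_eq_zero (by simpa [Nat.lt_succ_iff] using hk)]
    simp

lemma hasSum_pow_div_factorial (x : ℝ) :
    HasSum (fun k : ℕ => x ^ k / k.factorial) (Real.exp x) := by
  rw [Real.exp_eq_exp_ℝ]
  exact NormedSpace.expSeries_div_hasSum_exp x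

lemma norm_hyperCoeff_mul_le {b : ℂ} {c : ℝ} (hc : 0 < c) {W r : ℝ} {z : ℂ} (k : ℕ)
    (hz : ‖z‖ ≤ r * W ^ k) :
    ‖hyperCoeff b c k * z‖ ≤ r * (((‖b‖ / c + 1) * W) ^ k / k.factorial) := by
  rw [norm_mul]
  refine (mul_le_mul (norm_hyperCoeff_le b hc k) hz (norm_nonneg _) (by positivity)).trans_eq ?_
  rw [mul_pow]; ring

lemma summable_hyperCoeff_mul {b : ℂ} {c : ℝ} (hc : 0 < c) {W : ℝ} {z : ℕ → ℂ}
    (hz : ∀ k, ‖z k‖ ≤ W ^ k) : Summable fun k => hyperCoeff b c k * z k :=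
  .of_norm_bounded (hasSum_pow_div_factorial ((‖b‖ / c + 1) * W)).summable fun k =>
    (norm_hyperCoeff_mul_le (b := b) hc (r := 1) k (by simpa using hz k)).trans_eq (one_mul _)

lemma oneF1_eq_tsum (b : ℂ) (c : ℝ) (z : ℂ) : oneF1 b c z = ∑' k, hyperCoeff b c k * z ^ k := rfl

lemma unifRate_twoF1neg (b : ℂ) {c : ℝ} (hc : 0 < c) (R : ℝ) {m : ℕ → ℕ}
    (hm : ∀ N, m N ≤ N) (hm' : ∀ N, N ≤ m N + 1) :
    UnifRate (strip R) (fun N t => twoF1neg (m N) b c (-(argN N t / N)))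
      (fun t => oneF1 b c (2 * I * t)) := by
  set W : ℝ := 4 * |R| + 1 with hWdef
  have hW : 1 ≤ W := by have := abs_nonneg R; linarith
  have hz : ∀ t ∈ strip R, ‖2 * I * t‖ ≤ W := fun t ht => by
    have := ht.2.trans (le_abs_self R)
    simp only [norm_mul, Complex.norm_ofNat, norm_I, mul_one]
    linarith [norm_nonneg t]
  refine ⟨⟨Real.exp ((‖b‖ / c + 1) * W), fun t ht => ?_⟩,
    (1 + 4 * R ^ 2) * Real.exp ((‖b‖ / c + 1) * (4 * W)), fun N hN t ht => ?_⟩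
  · beta_reduce
    rw [oneF1_eq_tsum]
    refine tsum_of_norm_bounded (hasSum_pow_div_factorial _) fun k => ?_
    refine (norm_hyperCoeff_mul_le (r := 1) hc k ?_).trans_eq (one_mul _)
    rw [norm_pow, one_mul]
    exact pow_le_pow_left₀ (norm_nonneg _) (hz t ht) k
  · have hN' : (1 : ℝ) ≤ N := by exact_mod_cast hN
    have hd := norm_argN_sub_le ht hN
    have hw : ‖argN N t‖ ≤ W := (norm_argN_le ht hN).trans (by have := le_abs_self R; linarith)
    have hz := hz t ht
    have hb := fallingRatio_bounds hN (hm N) (hm' N)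
    beta_reduce
    rw [twoF1neg_eq_tsum, oneF1_eq_tsum]
    generalize argN N t = w at *
    generalize 2 * I * t = z at *
    have hwk : ∀ k : ℕ, ‖w ^ k‖ ≤ W ^ k := fun k => by
      rw [norm_pow]; exact pow_le_pow_left₀ (norm_nonneg _) hw k
    have hzk : ∀ k : ℕ, ‖z ^ k‖ ≤ W ^ k := fun k => by
      rw [norm_pow]; exact pow_le_pow_left₀ (norm_nonneg _) hz k
    have hfk : ∀ k, ‖(fallingRatio (m N) N k : ℂ)‖ ≤ 1 := fun k => by
      rw [Complex.norm_real, Real.norm_eq_abs, abs_of_nonneg (hb k).1]; exact (hb k).2.1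
    have hfk' : ∀ k, ‖(fallingRatio (m N) N k : ℂ) - 1‖ ≤ (k : ℝ) ^ 2 / N := fun k => by
      rw [← Complex.ofReal_one, ← Complex.ofReal_sub, Complex.norm_real, Real.norm_eq_abs,
        abs_sub_comm, abs_of_nonneg (by linarith [(hb k).2.1])]
      linarith [(hb k).2.2]
    have hfw : ∀ k, ‖fallingRatio (m N) N k * w ^ k‖ ≤ W ^ k := fun k => by
      rw [norm_mul]
      exact (mul_le_mul (hfk k) (hwk k) (norm_nonneg _) zero_le_one).trans_eq (one_mul _)
    rw [← (summable_hyperCoeff_mul hc hfw).tsum_sub (summable_hyperCoeff_mul hc hzk)]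
    refine (tsum_of_norm_bounded
      ((hasSum_pow_div_factorial ((‖b‖ / c + 1) * (4 * W))).mul_left ((1 + 4 * R ^ 2) / N))
      fun k => ?_).trans_eq (by ring)
    rw [← mul_sub]
    refine norm_hyperCoeff_mul_le hc k ?_
    have hk4 : (k : ℝ) ^ 2 ≤ 4 ^ k := by
      have : (k : ℝ) ≤ 2 ^ k := by exact_mod_cast Nat.lt_two_pow_self.le
      calc (k : ℝ) ^ 2 ≤ (2 ^ k) ^ 2 := by gcongr
        _ = 4 ^ k := by rw [← pow_mul, mul_comm, pow_mul]; norm_num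
    have hk4' : (k : ℝ) ≤ 4 ^ k := by
      refine le_trans ?_ hk4
      rcases Nat.eq_zero_or_pos k with rfl | hk
      · simp
      · have : (1 : ℝ) ≤ k := by exact_mod_cast hk
        nlinarith
    calc ‖fallingRatio (m N) N k * w ^ k - z ^ k‖
        = ‖((fallingRatio (m N) N k : ℂ) - 1) * w ^ k + (w ^ k - z ^ k)‖ := by ring_nf
      _ ≤ ‖(fallingRatio (m N) N k : ℂ) - 1‖ * ‖w ^ k‖ + ‖w ^ k - z ^ k‖ :=
          (norm_add_le _ _).trans (by rw [norm_mul])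
      _ ≤ (k : ℝ) ^ 2 / N * W ^ k + k * W ^ k * (4 * R ^ 2 / N) := by
          refine add_le_add (mul_le_mul (hfk' k) (hwk k) (norm_nonneg _) (by positivity)) ?_
          exact (norm_pow_sub_pow_le_mul hW hw hz k).trans (by gcongr)
      _ ≤ 4 ^ k / N * W ^ k + 4 ^ k * W ^ k * (4 * R ^ 2 / N) := by gcongr
      _ = (1 + 4 * R ^ 2) / N * (4 * W) ^ k := by rw [mul_pow]; ring

/-! ### The Gamma factor -/

lemma abs_Gamma_ratio_sub_one_le {c : ℝ} (hc : -1 < c) (hc' : c ≤ 0) {N : ℕ} (hN : 1 ≤ N) :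
    |Real.Gamma (c + N + 1) / (Real.Gamma (N + 1) * (N : ℝ) ^ c) - 1| ≤ 1 / N := by
  have hN' : (1 : ℝ) ≤ N := by exact_mod_cast hN
  have hN0 : (0 : ℝ) < N := by linarith
  have hG : ∀ {y : ℝ}, 0 < y →
      (Real.log ∘ Real.Gamma) (y + 1) = (Real.log ∘ Real.Gamma) y + Real.log y := fun {y} hy => by
    simp only [Function.comp_apply]
    rw [Real.Gamma_add_one hy.ne', Real.log_mul hy.ne' (Real.Gamma_pos_of_pos hy).ne', add_comm]
  have hΓ₁ : 0 < Real.Gamma (c + N + 1) := Real.Gamma_pos_of_pos (by linarith)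
  have hΓ₂ : 0 < Real.Gamma N := Real.Gamma_pos_of_pos hN0
  have hden : Real.Gamma (N + 1) * (N : ℝ) ^ c = Real.Gamma N * (N : ℝ) ^ (c + 1) := by
    rw [Real.Gamma_add_one hN0.ne', Real.rpow_add_one hN0.ne']
    ring
  have hpos : 0 < Real.Gamma N * (N : ℝ) ^ (c + 1) := by positivity
  have hx : (N : ℝ) + (c + 1) = c + N + 1 := by ring
  rw [hden]
  set ρ := Real.Gamma (c + N + 1) / (Real.Gamma N * (N : ℝ) ^ (c + 1)) with hρ
  have hρ0 : 0 < ρ := div_pos hΓ₁ hpos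
  have hlog : Real.log ρ =
      Real.log (Real.Gamma (c + N + 1)) - Real.log (Real.Gamma N) - (c + 1) * Real.log N := by
    rw [hρ, Real.log_div hΓ₁.ne' hpos.ne', Real.log_mul hΓ₂.ne' (by positivity),
      Real.log_rpow hN0]
    ring
  have hup : ρ ≤ 1 := by
    have h := Real.BohrMollerup.f_add_nat_le (x := c + 1) (n := N) Real.convexOn_log_Gamma hG
      (by omega) (by linarith) (by linarith)
    rw [hx] at h
    simp only [Function.comp_apply] at h
    rw [← Real.log_nonpos_iff hρ0.le, hlog]
    linarith
  have hlow : 1 - 1 / (N : ℝ) ≤ ρ := by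
    rcases hN.eq_or_lt with rfl | h2
    · simpa using hρ0.le
    · have h := Real.BohrMollerup.f_add_nat_ge (x := c + 1) (n := N) Real.convexOn_log_Gamma hG
        h2 (by linarith)
      rw [hx] at h
      simp only [Function.comp_apply] at h
      have h2' : (2 : ℝ) ≤ N := by exact_mod_cast h2
      have e : 1 - 1 / (N : ℝ) = (N - 1) / N := by field_simp
      rw [e, ← Real.log_le_log_iff (div_pos (by linarith) hN0) hρ0,
        Real.log_div (by linarith) hN0.ne', hlog]
      have hmono : Real.log ((N : ℝ) - 1) ≤ Real.log N :=
        Real.log_le_log (by linarith) (by linarith)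
      nlinarith
  rw [abs_le]
  constructor
  · linarith
  · have : 0 ≤ 1 / (N : ℝ) := by positivity
    linarith

lemma exists_abs_Gamma_ratio_sub_one_le {c : ℝ} (hc : -1 < c) :
    ∃ C : ℝ, ∀ N : ℕ, 1 ≤ N →
      |Real.Gamma (c + N + 1) / (Real.Gamma (N + 1) * (N : ℝ) ^ c) - 1| ≤ C / N := by
  suffices H : ∀ n : ℕ, ∀ c : ℝ, -1 < c → c ≤ n → ∃ C : ℝ, ∀ N : ℕ, 1 ≤ N →
      |Real.Gamma (c + N + 1) / (Real.Gamma (N + 1) * (N : ℝ) ^ c) - 1| ≤ C / N from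
    H ⌈c⌉₊ c hc (Nat.le_ceil c)
  intro n
  induction n with
  | zero =>
    intro c hc hc'
    exact ⟨1, fun N hN => abs_Gamma_ratio_sub_one_le hc (by simpa using hc') hN⟩
  | succ n ih =>
    intro c hc hcn
    rcases le_or_gt c 0 with h0 | h0
    · exact ⟨1, fun N hN => abs_Gamma_ratio_sub_one_le hc h0 hN⟩
    obtain ⟨C, hC⟩ := ih (c - 1) (by linarith) (by push_cast at hcn; linarith)
    refine ⟨C * (1 + c) + c, fun N hN => ?_⟩
    have hN' : (1 : ℝ) ≤ N := by exact_mod_cast hN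
    have hN0 : (0 : ℝ) < N := by linarith
    have e := hC N hN
    have hΓ : Real.Gamma (c + N + 1) = (c + N) * Real.Gamma (c - 1 + N + 1) := by
      rw [Real.Gamma_add_one (by positivity)]
      ring_nf
    have hΓN : 0 < Real.Gamma ((N : ℝ) + 1) := Real.Gamma_pos_of_pos (by linarith)
    have hpow : (N : ℝ) ^ c = N ^ (c - 1) * N := by
      rw [← Real.rpow_add_one hN0.ne']; ring_nf
    have hp : 0 < (N : ℝ) ^ (c - 1) := by positivity
    rw [hΓ, hpow]
    set ρ := Real.Gamma (c - 1 + N + 1) / (Real.Gamma (N + 1) * (N : ℝ) ^ (c - 1)) with hρ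
    have key : (c + N) * Real.Gamma (c - 1 + N + 1) / (Real.Gamma (N + 1) * (N ^ (c - 1) * N)) - 1
        = (ρ - 1) * (1 + c / N) + c / N := by
      rw [hρ]; field_simp; ring
    have hcN : c / N ≤ c := div_le_self h0.le hN'
    have hcN0 : 0 ≤ c / N := by positivity
    rw [key]
    calc |(ρ - 1) * (1 + c / N) + c / N| ≤ |ρ - 1| * |1 + c / N| + |c / N| :=
          (abs_add_le _ _).trans (by rw [abs_mul])
      _ = |ρ - 1| * (1 + c / N) + c / N := by
          rw [abs_of_nonneg hcN0, abs_of_nonneg (by linarith : 0 ≤ 1 + c / (N : ℝ))]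
      _ ≤ C / N * (1 + c) + c / N :=
          add_le_add (mul_le_mul e (by linarith) (by linarith) ((abs_nonneg _).trans e)) le_rfl
      _ = _ := by ring

/-- The normalised Gamma factor `(Γ(2a+N+1) / Γ(N+1))^{1/2} N^{-a}`. -/
def gammaFac (a : ℝ) (N : ℕ) : ℝ :=
  Real.sqrt (Real.Gamma (2 * a + N + 1) / Real.Gamma (N + 1)) * (N : ℝ) ^ (-a)

lemma exists_abs_gammaFac_sub_one_le {a : ℝ} (ha : -(1 / 2) < a) :
    ∃ C : ℝ, ∀ N : ℕ, 1 ≤ N → |gammaFac a N - 1| ≤ C / N := by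
  obtain ⟨C, hC⟩ := exists_abs_Gamma_ratio_sub_one_le (c := 2 * a) (by linarith)
  refine ⟨C, fun N hN => le_trans ?_ (hC N hN)⟩
  have hN0 : (0 : ℝ) < N := by exact_mod_cast hN
  have hp : 0 < (N : ℝ) ^ a := by positivity
  have hΓ : 0 < Real.Gamma (2 * a + N + 1) := Real.Gamma_pos_of_pos (by linarith)
  have hΓN : 0 < Real.Gamma ((N : ℝ) + 1) := Real.Gamma_pos_of_pos (by linarith)
  have hsq : (N : ℝ) ^ (2 * a) = ((N : ℝ) ^ a) ^ 2 := by
    rw [mul_comm, Real.rpow_mul hN0.le, Real.rpow_two]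
  have e : gammaFac a N =
      Real.sqrt (Real.Gamma (2 * a + N + 1) / (Real.Gamma (N + 1) * (N : ℝ) ^ (2 * a))) := by
    rw [hsq, ← div_div, Real.sqrt_div (by positivity) (((N : ℝ) ^ a) ^ 2), Real.sqrt_sq hp.le,
      gammaFac, Real.rpow_neg hN0.le, ← div_eq_mul_inv]
  rw [e]
  have hρ : 0 ≤ Real.Gamma (2 * a + N + 1) / (Real.Gamma (N + 1) * (N : ℝ) ^ (2 * a)) := by
    positivity
  generalize Real.Gamma (2 * a + N + 1) / (Real.Gamma (N + 1) * (N : ℝ) ^ (2 * a)) = ρ at hρ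
  have h1 : ρ - 1 = (Real.sqrt ρ - 1) * (Real.sqrt ρ + 1) := by
    linear_combination -(Real.sq_sqrt hρ)
  rw [h1, abs_mul]
  refine le_mul_of_one_le_right (abs_nonneg _) ?_
  rw [abs_of_nonneg (by positivity)]
  linarith [Real.sqrt_nonneg ρ]

lemma unifRate_gammaFac (D : Set ℂ) {a : ℝ} (ha : -(1 / 2) < a) (K : ℝ) :
    UnifRate D (fun N _ => ((K * gammaFac a N : ℝ) : ℂ)) (fun _ => (K : ℂ)) := by
  obtain ⟨C, hC⟩ := exists_abs_gammaFac_sub_one_le ha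
  refine UnifRate.const D (C := |K| * C) fun N hN => ?_
  rw [← Complex.ofReal_sub, Complex.norm_real, Real.norm_eq_abs, mul_div_assoc,
    show K * gammaFac a N - K = K * (gammaFac a N - 1) by ring, abs_mul]
  exact mul_le_mul_of_nonneg_left (hC N hN) (abs_nonneg _)

/-! ### The weight -/

lemma sub_I_pow_mul_sqrt_wH (s : ℂ) (N : ℕ) {y : ℝ} (hy : 0 < y) :
    ((y : ℂ) - I) ^ N * (Real.sqrt (wH s N y) : ℂ) =
      ((y ^ (-s.re) * Real.exp (Real.pi * s.im / 2) : ℝ) : ℂ) *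
        Complex.exp (((N - s) * Complex.log (1 - I * (y : ℂ)⁻¹) -
          (N + (starRingEnd ℂ) s) * Complex.log (1 - -(I * (y : ℂ)⁻¹))) / 2) := by
  have hyC : (y : ℂ) ≠ 0 := by exact_mod_cast hy.ne'
  set z : ℂ := 1 - I * (y : ℂ)⁻¹ with hz
  have hzre : z.re = 1 := by simp [hz, ← Complex.ofReal_inv]
  have hzim : z.im = -y⁻¹ := by simp [hz, ← Complex.ofReal_inv]
  have hz0 : z ≠ 0 := fun h => by simp [h] at hzre
  have hconj : 1 - -(I * (y : ℂ)⁻¹) = (starRingEnd ℂ) z := by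
    simp [hz]
  have harglt : |z.arg| < Real.pi / 2 := by
    rw [Complex.abs_arg_lt_pi_div_two_iff]; left; rw [hzre]; exact one_pos
  have hargne : z.arg ≠ Real.pi := fun h => by
    rw [h, abs_of_pos Real.pi_pos] at harglt
    linarith [Real.pi_pos]
  obtain ⟨hlt, hgt⟩ := abs_lt.1 harglt
  have hargI : Complex.arg (1 + I * y) = Real.pi / 2 + z.arg := by
    have e : (1 : ℂ) + I * y = (y : ℂ) * (I * z) := by
      rw [hz]; field_simp; linear_combination Complex.I_sq
    rw [e, Complex.arg_real_mul _ hy, Complex.arg_mul I_ne_zero hz0, Complex.arg_I]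
    rw [Complex.arg_I]
    constructor <;> linarith
  have hr : 0 < ‖z‖ := norm_pos_iff.2 hz0
  have hnorm : 1 + y ^ 2 = (y * ‖z‖) ^ 2 := by
    rw [mul_pow, Complex.sq_norm, Complex.normSq_apply, hzre, hzim]
    field_simp
    ring
  have hsqrt : Real.sqrt (wH s N y) =
      (y * ‖z‖) ^ (-s.re - (N : ℝ)) * Real.exp (s.im * (Real.pi / 2 + z.arg)) := by
    have hp : 0 ≤ y * ‖z‖ := by positivity
    have : wH s N y = ((y * ‖z‖) ^ (-s.re - (N : ℝ)) *
        Real.exp (s.im * (Real.pi / 2 + z.arg))) ^ 2 := by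
      rw [wH, hargI, hnorm, mul_pow ((y * ‖z‖) ^ (-s.re - (N : ℝ))), ← Real.exp_nat_mul, ← Real.rpow_natCast (y * ‖z‖) 2,
        ← Real.rpow_mul hp, ← Real.rpow_natCast ((y * ‖z‖) ^ (-s.re - (N : ℝ))),
        ← Real.rpow_mul hp]
      push_cast
      ring_nf
    rw [this, Real.sqrt_sq (by positivity)]
  have hrpow : (y * ‖z‖) ^ (-s.re - (N : ℝ)) =
      y ^ (-s.re) / y ^ N * Real.exp (Real.log ‖z‖ * (-s.re - N)) := by
    rw [Real.mul_rpow hy.le hr.le, Real.rpow_sub hy, Real.rpow_natCast,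
      Real.rpow_def_of_pos hr]
  have hlog : Complex.log z = Real.log ‖z‖ + z.arg * I := rfl
  have hbase : (y : ℂ) - I = y * z := by
    rw [hz]; field_simp
  have hpow : z ^ N = Complex.exp (N * (Real.log ‖z‖ + z.arg * I)) := by
    rw [← hlog, Complex.exp_nat_mul, Complex.exp_log hz0]
  rw [hsqrt, hrpow, hconj, Complex.log_conj _ hargne, hlog, hbase, mul_pow, hpow]
  simp only [map_add, map_mul, Complex.conj_ofReal, Complex.conj_I]
  push_cast
  generalize (Real.log ‖z‖ : ℂ) = r
  generalize (z.arg : ℂ) = θ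
  have hsplit : s = s.re + s.im * I := (Complex.re_add_im s).symm
  have hsconj : (starRingEnd ℂ) s = s.re - s.im * I := by
    apply Complex.ext <;> simp
  have hexp : ((N - s) * (r + θ * I) - (N + (starRingEnd ℂ) s) * (r + θ * -I)) / 2 =
      N * (r + θ * I) + r * (-s.re - N) + s.im * θ := by
    rw [hsconj]
    nth_rewrite 1 [hsplit]
    linear_combination (-(s.im : ℂ) * θ) * Complex.I_sq
  have hexp2 : (s.im : ℂ) * (Real.pi / 2 + θ) = Real.pi * s.im / 2 + s.im * θ := by ring
  rw [hexp, hexp2, Complex.exp_add, Complex.exp_add, Complex.exp_add]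
  have hyN : (y : ℂ) ^ N ≠ 0 := pow_ne_zero _ hyC
  field_simp

/-! ### Passing from `t = 1 / x` to `x` -/

lemma rpow_mul_comp_inv_bounds {h : ℝ → ℂ} {H : ℂ → ℂ} {α T ε x : ℝ}
    (hH : ∀ t ∈ strip (T + 1), DifferentiableAt ℂ H t) (hbd : ∀ t ∈ strip (T + 1), ‖H t‖ ≤ ε)
    (hh : ∀ x : ℝ, 0 < x → h x = ((x ^ (-α) : ℝ) : ℂ) * H ((x : ℂ)⁻¹))
    (hx : 0 < x) (hxT : x⁻¹ ≤ T) :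
    DifferentiableAt ℝ h x ∧ ‖h x‖ ≤ ε / x ^ α ∧
      ‖deriv h x‖ ≤ (|α| + 2 * T) * ε / x ^ (1 + α) := by
  have hxi : 0 < x⁻¹ := inv_pos.2 hx
  have hT : 0 ≤ T := hxi.le.trans hxT
  have hball : Metric.closedBall ((x⁻¹ : ℝ) : ℂ) (1 / 2) ⊆ strip (T + 1) := by
    intro t ht
    rw [Metric.mem_closedBall, dist_eq_norm] at ht
    constructor
    · have := (Complex.abs_im_le_norm (t - ((x⁻¹ : ℝ) : ℂ))).trans ht
      rwa [Complex.sub_im, Complex.ofReal_im, sub_zero] at this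
    · have h1 : ‖((x⁻¹ : ℝ) : ℂ)‖ = x⁻¹ := by
        rw [Complex.norm_real, Real.norm_eq_abs, abs_of_pos hxi]
      have h2 := norm_le_norm_add_norm_sub' t ((x⁻¹ : ℝ) : ℂ)
      linarith
  have hmem : ((x⁻¹ : ℝ) : ℂ) ∈ strip (T + 1) := hball (Metric.mem_closedBall_self (by norm_num))
  have hε : 0 ≤ ε := (norm_nonneg _).trans (hbd _ hmem)
  have hHd : ‖deriv H ((x⁻¹ : ℝ) : ℂ)‖ ≤ 2 * ε := by
    have := Complex.norm_deriv_le_of_forall_mem_sphere_norm_le (f := H) (C := ε)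
      (c := ((x⁻¹ : ℝ) : ℂ)) (R := 1 / 2) (by norm_num)
      (DifferentiableOn.diffContOnCl fun t ht =>
        (hH t (hball (Metric.closure_ball_subset_closedBall ht))).differentiableWithinAt)
      (fun t ht => hbd t (hball (Metric.sphere_subset_closedBall ht)))
    linarith
  have hder₁ : HasDerivAt (fun x : ℝ => ((x ^ (-α) : ℝ) : ℂ)) ((-α * x ^ (-α - 1) : ℝ) : ℂ) x :=
    (Real.hasDerivAt_rpow_const (Or.inl hx.ne')).ofReal_comp
  have hder₂ : HasDerivAt (fun x : ℝ => H ((x⁻¹ : ℝ) : ℂ))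
      ((-(x ^ 2)⁻¹) • deriv H ((x⁻¹ : ℝ) : ℂ)) x :=
    HasDerivAt.scomp x (hH _ hmem).hasDerivAt.comp_ofReal (hasDerivAt_inv hx.ne')
  have hder := hder₁.mul hder₂
  have hev : h =ᶠ[nhds x] fun x : ℝ => ((x ^ (-α) : ℝ) : ℂ) * H ((x⁻¹ : ℝ) : ℂ) := by
    filter_upwards [lt_mem_nhds hx] with y hy
    rw [hh y hy, Complex.ofReal_inv]
  have hder' := hder.congr_of_eventuallyEq hev
  have hxα : 0 < x ^ α := by positivity
  refine ⟨hder'.differentiableAt, ?_, ?_⟩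
  · rw [hev.self_of_nhds, norm_mul, Complex.norm_real, Real.norm_eq_abs,
      abs_of_pos (by positivity), Real.rpow_neg hx.le, inv_mul_eq_div]
    gcongr
    exact hbd _ hmem
  · have e₁ : x ^ (-α - 1) = (x ^ (1 + α))⁻¹ := by
      rw [← Real.rpow_neg hx.le]; ring_nf
    have e₂ : x ^ (-α) * (x ^ 2)⁻¹ = (x ^ (1 + α))⁻¹ * x⁻¹ := by
      rw [Real.rpow_add hx, Real.rpow_one, Real.rpow_neg hx.le]
      field_simp
    have hp : 0 < x ^ (1 + α) := by positivity
    rw [hder'.deriv]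
    refine (norm_add_le _ _).trans ?_
    rw [norm_mul, norm_mul, norm_smul, Complex.norm_real, Complex.norm_real, Real.norm_eq_abs,
      Real.norm_eq_abs, Real.norm_eq_abs, abs_mul, abs_neg, abs_neg,
      abs_of_pos (by positivity : 0 < x ^ (-α - 1)), abs_of_pos (by positivity : 0 < x ^ (-α)),
      abs_of_pos (by positivity : 0 < (x ^ 2)⁻¹), ← mul_assoc (x ^ (-α)), e₁, e₂]
    calc |α| * (x ^ (1 + α))⁻¹ * ‖H ((x⁻¹ : ℝ) : ℂ)‖ +
          (x ^ (1 + α))⁻¹ * x⁻¹ * ‖deriv H ((x⁻¹ : ℝ) : ℂ)‖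
        ≤ |α| * (x ^ (1 + α))⁻¹ * ε + (x ^ (1 + α))⁻¹ * T * (2 * ε) := by
          gcongr
          exact hbd _ hmem
      _ = (|α| + 2 * T) * ε / x ^ (1 + α) := by ring

lemma UnifRate.exists_iteratedDeriv_bound {f : ℕ → ℝ → ℂ} {g : ℝ → ℂ} {F : ℕ → ℂ → ℂ}
    {G : ℂ → ℂ} {α x₀ : ℝ} (hx₀ : 0 < x₀) (hFG : UnifRate (strip (x₀⁻¹ + 1)) F G)
    (hF : ∀ N : ℕ, 1 ≤ N → ∀ t ∈ strip (x₀⁻¹ + 1), DifferentiableAt ℂ (F N) t)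
    (hG : Differentiable ℂ G)
    (hf : ∀ N : ℕ, 1 ≤ N → ∀ x : ℝ, 0 < x → f N x = ((x ^ (-α) : ℝ) : ℂ) * F N ((x : ℂ)⁻¹))
    (hg : ∀ x : ℝ, 0 < x → g x = ((x ^ (-α) : ℝ) : ℂ) * G ((x : ℂ)⁻¹)) :
    ∃ C : ℝ, 0 ≤ C ∧ ∀ N : ℕ, 1 ≤ N → ∀ p : ℕ, p ≤ 1 → ∀ x : ℝ, x₀ < x →
      ‖iteratedDeriv p (f N) x - iteratedDeriv p g x‖ ≤ (1 / N) * (C / x ^ ((p : ℝ) + α)) := by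
  obtain ⟨⟨M, hM⟩, C, hC⟩ := hFG
  refine ⟨(1 + |α| + 2 * x₀⁻¹) * |C|, by positivity, fun N hN p hp x hx => ?_⟩
  have hx0 : 0 < x := hx₀.trans hx
  have hxT : x⁻¹ ≤ x₀⁻¹ := inv_anti₀ hx₀ hx.le
  have hbd : ∀ t ∈ strip (x₀⁻¹ + 1), ‖F N t - G t‖ ≤ |C| / N := fun t ht =>
    (hC N hN t ht).trans (by gcongr; exact le_abs_self C)
  have hM' : ∀ t ∈ strip (x₀⁻¹ + 1), ‖F N t‖ ≤ M + |C| / N := fun t ht => by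
    have := norm_le_norm_add_norm_sub' (F N t) (G t)
    linarith [hM t ht, hbd t ht]
  have df := (rpow_mul_comp_inv_bounds (hF N hN) hM' (hf N hN) hx0 hxT).1
  have dg := (rpow_mul_comp_inv_bounds (fun t _ => hG t) hM hg hx0 hxT).1
  obtain ⟨-, b₀, b₁⟩ := rpow_mul_comp_inv_bounds (h := fun x => f N x - g x)
    (fun t ht => (hF N hN t ht).sub (hG t)) hbd
    (fun x hx => by rw [hf N hN x hx, hg x hx]; exact (mul_sub _ _ _).symm) hx0 hxT
  interval_cases p
  · have hpos : 0 < x ^ α := by positivity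
    simp only [iteratedDeriv_zero, Nat.cast_zero, zero_add]
    refine b₀.trans ?_
    rw [one_div, inv_mul_eq_div, div_right_comm]
    gcongr
    have h : 0 ≤ |α| + 2 * x₀⁻¹ := by positivity
    nlinarith [abs_nonneg C]
  · have hpos : 0 < x ^ (1 + α) := by positivity
    simp only [iteratedDeriv_one, Nat.cast_one]
    rw [← deriv_fun_sub df dg]
    refine b₁.trans ?_
    rw [one_div, inv_mul_eq_div, ← mul_div_assoc, div_right_comm]
    gcongr
    linarith

/-! ### Differentiability of the factors -/

lemma differentiableAt_I_mul_div (N : ℕ) (t : ℂ) :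
    DifferentiableAt ℂ (fun t : ℂ => I * (t / N)) t := by fun_prop

lemma differentiableAt_expoN (s : ℂ) {R : ℝ} {N : ℕ} (hN : 1 ≤ N) {t : ℂ} (ht : t ∈ strip R) :
    DifferentiableAt ℂ (expoN s N) t := by
  have hre := abs_re_I_mul_div_le ht hN
  have h1 : DifferentiableAt ℂ (fun t : ℂ => Complex.log (1 - I * (t / N))) t :=
    ((differentiableAt_I_mul_div N t).const_sub 1).clog (one_sub_mem_slitPlane hre)
  have h2 : DifferentiableAt ℂ (fun t : ℂ => Complex.log (1 - -(I * (t / N)))) t :=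
    ((differentiableAt_I_mul_div N t).neg.const_sub 1).clog
      (one_sub_mem_slitPlane (by simpa using hre))
  exact ((h1.const_mul _).sub (h2.const_mul _)).div_const 2

lemma differentiableAt_inv_one_sub {R : ℝ} {N : ℕ} (hN : 1 ≤ N) {t : ℂ} (ht : t ∈ strip R) :
    DifferentiableAt ℂ (fun t : ℂ => (1 - I * (t / N))⁻¹) t :=
  ((differentiableAt_I_mul_div N t).const_sub 1).inv (one_sub_ne_zero (abs_re_I_mul_div_le ht hN))

lemma differentiableAt_twoF1neg_argN (m : ℕ) (b c : ℂ) {R : ℝ} {N : ℕ} (hN : 1 ≤ N) {t : ℂ}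
    (ht : t ∈ strip R) :
    DifferentiableAt ℂ (fun t : ℂ => twoF1neg m b c (-(argN N t / N))) t := by
  have h : DifferentiableAt ℂ (argN N) t := by
    have h1 := differentiableAt_inv_one_sub hN ht
    have h2 : DifferentiableAt ℂ (fun t : ℂ => 2 * I * t) t := by fun_prop
    exact h2.mul h1
  unfold twoF1neg
  fun_prop

lemma differentiable_oneF1 (b : ℂ) {c : ℝ} (hc : 0 < c) :
    Differentiable ℂ (oneF1 b (c : ℂ)) := by
  intro z
  have hd := Complex.differentiableOn_tsum_of_summable_norm
    (U := Metric.ball (0 : ℂ) (‖z‖ + 1)) (F := fun k z => hyperCoeff b c k * z ^ k)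
    (hasSum_pow_div_factorial ((‖b‖ / c + 1) * (‖z‖ + 1))).summable
    (fun k => by fun_prop) Metric.isOpen_ball
    (fun k w hw => by
      refine (norm_hyperCoeff_mul_le (r := 1) hc k ?_).trans_eq (one_mul _)
      rw [norm_pow, one_mul]
      exact pow_le_pow_left₀ (norm_nonneg _) (mem_ball_zero_iff.1 hw).le k)
  exact hd.differentiableAt (Metric.isOpen_ball.mem_nhds (by simp))

/-! ### The factorisations in the variable `t = 1 / x` -/

lemma two_div_one_add_eq {N : ℕ} (hN : 1 ≤ N) {x : ℝ} (hx : 0 < x) :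
    2 / (1 + I * ((N * x : ℝ) : ℂ)) = -(argN N ((x : ℂ)⁻¹) / N) := by
  have hN0 : (N : ℂ) ≠ 0 := by exact_mod_cast (by omega : N ≠ 0)
  have hx0 : (x : ℂ) ≠ 0 := by exact_mod_cast hx.ne'
  have h2 : (N : ℂ) * x - I ≠ 0 := fun h => by
    simpa using congrArg Complex.im h
  have h3 : (1 : ℂ) - I * ((x : ℂ)⁻¹ / N) = (N * x - I) / (N * x) := by field_simp
  have h4 : 1 + I * ((N * x : ℝ) : ℂ) = I * (N * x - I) := by
    push_cast
    linear_combination Complex.I_sq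
  rw [argN, h3, h4]
  generalize (N : ℂ) * x - I = d at *
  field_simp
  linear_combination Complex.I_sq

lemma sub_I_pow_mul_sqrt_wH_eq_expoN (s : ℂ) {N : ℕ} (hN : 1 ≤ N) {x : ℝ} (hx : 0 < x) :
    (((N * x : ℝ) : ℂ) - I) ^ N * (Real.sqrt (wH s N (N * x)) : ℂ) =
      ((((N : ℝ) ^ (-s.re) * x ^ (-s.re)) * Real.exp (Real.pi * s.im / 2) : ℝ) : ℂ) *
        Complex.exp (expoN s N ((x : ℂ)⁻¹)) := by
  have hN0 : (0 : ℝ) < N := by exact_mod_cast hN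
  have e : ((N * x : ℝ) : ℂ)⁻¹ = (x : ℂ)⁻¹ / N := by
    push_cast
    rw [mul_inv, div_eq_mul_inv, mul_comm]
  rw [sub_I_pow_mul_sqrt_wH s N (mul_pos hN0 hx), e, Real.mul_rpow hN0.le hx.le, expoN]

lemma PtildeN_eq (s : ℂ) {N : ℕ} (hN : 1 ≤ N) {x : ℝ} (hx : 0 < x) :
    PtildeN s N x = ((x ^ (-s.re) : ℝ) : ℂ) *
      (((((2 : ℝ) ^ s.re * Real.exp (Real.pi * s.im / 2) * gammaFac s.re N : ℝ) : ℂ) *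
        Complex.exp (expoN s N ((x : ℂ)⁻¹))) *
        twoF1neg N s ((2 * s.re + 1 : ℝ) : ℂ) (-(argN N ((x : ℂ)⁻¹) / N))) := by
  have hN0 : (0 : ℝ) < N := by exact_mod_cast hN
  have key := sub_I_pow_mul_sqrt_wH_eq_expoN s hN hx
  rw [PtildeN, pTil, two_div_one_add_eq hN hx, gammaFac, Real.Gamma_add_one hN0.ne']
  generalize twoF1neg N s _ _ = Φ
  push_cast at key ⊢
  linear_combination
    ((2 : ℝ) ^ s.re : ℝ) * (Real.sqrt (Real.Gamma (2 * s.re + N + 1) / (N * Real.Gamma N)) : ℂ) *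
      Φ * key

lemma QN_eq (s : ℂ) {N : ℕ} (hN : 1 ≤ N) {x : ℝ} (hx : 0 < x) :
    QN s N x = ((x ^ (-(1 + s.re)) : ℝ) : ℂ) *
      ((((((2 : ℝ) ^ (s.re + 1) * Real.exp (Real.pi * s.im / 2) * gammaFac s.re N : ℝ) : ℂ) *
        Complex.exp (expoN s N ((x : ℂ)⁻¹))) * (1 - I * ((x : ℂ)⁻¹ / N))⁻¹) *
        twoF1neg (N - 1) (s + 1) ((2 * s.re + 2 : ℝ) : ℂ) (-(argN N ((x : ℂ)⁻¹) / N))) := by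
  have hN0 : (0 : ℝ) < N := by exact_mod_cast hN
  have hNC : (N : ℂ) ≠ 0 := by exact_mod_cast hN0.ne'
  have hxC : (x : ℂ) ≠ 0 := by exact_mod_cast hx.ne'
  have key := sub_I_pow_mul_sqrt_wH_eq_expoN s hN hx
  have hbase : ((N * x : ℝ) : ℂ) - I ≠ 0 := fun h => by
    simpa using congrArg Complex.im h
  have hfac : (N : ℂ) = ((x : ℂ)⁻¹ * (1 - I * ((x : ℂ)⁻¹ / N))⁻¹) * (((N * x : ℝ) : ℂ) - I) := by
    have h3 : (1 : ℂ) - I * ((x : ℂ)⁻¹ / N) = (((N * x : ℝ) : ℂ) - I) / (N * x) := by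
      push_cast; field_simp
    rw [h3]
    field_simp
  have hpow : (N : ℂ) * (((N * x : ℝ) : ℂ) - I) ^ (N - 1) =
      ((x : ℂ)⁻¹ * (1 - I * ((x : ℂ)⁻¹ / N))⁻¹) * (((N * x : ℝ) : ℂ) - I) ^ N := by
    obtain ⟨n, rfl⟩ : ∃ n, N = n + 1 := ⟨N - 1, by omega⟩
    rw [Nat.add_sub_cancel, pow_succ]
    linear_combination ((((n + 1 : ℕ) * x : ℝ) : ℂ) - I) ^ n * hfac
  have hsqrt : Real.sqrt (N * Real.Gamma (2 * s.re + N + 1) / Real.Gamma N) =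
      N * Real.sqrt (Real.Gamma (2 * s.re + N + 1) / (N * Real.Gamma N)) := by
    have e : N * Real.Gamma (2 * s.re + N + 1) / Real.Gamma N =
        (N : ℝ) ^ 2 * (Real.Gamma (2 * s.re + N + 1) / (N * Real.Gamma N)) := by
      field_simp
    rw [e, Real.sqrt_mul (by positivity), Real.sqrt_sq hN0.le]
  have hxpow : x ^ (-(1 + s.re)) = x⁻¹ * x ^ (-s.re) := by
    rw [neg_add, Real.rpow_add hx, Real.rpow_neg_one]
  rw [QN, pPrev, two_div_one_add_eq hN hx, hsqrt, hxpow, gammaFac, Real.Gamma_add_one hN0.ne']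
  generalize twoF1neg (N - 1) (s + 1) _ _ = Φ
  generalize (1 - I * ((x : ℂ)⁻¹ / N))⁻¹ = u at *
  push_cast at key hpow ⊢
  generalize (Real.sqrt (Real.Gamma (2 * s.re + N + 1) / (N * Real.Gamma N)) : ℂ) = γ
  linear_combination
    ((2 : ℝ) ^ (s.re + 1) : ℝ) * γ * Φ * (Real.sqrt (wH s N (N * x)) : ℂ) * hpow +
    ((2 : ℝ) ^ (s.re + 1) : ℝ) * γ * Φ * ((x : ℂ)⁻¹ * u) * key

lemma prefac_eq (s : ℂ) {x : ℝ} (hx : 0 < x) :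
    prefac s x = ((x ^ (-s.re) : ℝ) : ℂ) *
      ((((2 : ℝ) ^ s.re * Real.exp (Real.pi * s.im / 2) : ℝ) : ℂ) *
        Complex.exp (-(I * (x : ℂ)⁻¹))) := by
  rw [prefac, Real.sign_of_pos hx, mul_one, abs_of_pos (by positivity),
    Real.div_rpow zero_le_two hx.le, Real.rpow_neg hx.le, Complex.exp_add, neg_div,
    div_eq_mul_inv I]
  push_cast
  ring

lemma Ptilde_eq (s : ℂ) {x : ℝ} (hx : 0 < x) :
    Ptilde s x = ((x ^ (-s.re) : ℝ) : ℂ) *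
      (((((2 : ℝ) ^ s.re * Real.exp (Real.pi * s.im / 2) : ℝ) : ℂ) *
        Complex.exp (-(I * (x : ℂ)⁻¹))) *
        oneF1 s ((2 * s.re + 1 : ℝ) : ℂ) (2 * I * (x : ℂ)⁻¹)) := by
  rw [Ptilde, prefac_eq s hx, div_eq_mul_inv (2 * I), mul_assoc]

lemma Qfun_eq (s : ℂ) {x : ℝ} (hx : 0 < x) :
    Qfun s x = ((x ^ (-(1 + s.re)) : ℝ) : ℂ) *
      ((((((2 : ℝ) ^ (s.re + 1) * Real.exp (Real.pi * s.im / 2) : ℝ) : ℂ) *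
        Complex.exp (-(I * (x : ℂ)⁻¹))) * 1) *
        oneF1 (s + 1) ((2 * s.re + 2 : ℝ) : ℂ) (2 * I * (x : ℂ)⁻¹)) := by
  rw [Qfun, prefac_eq s hx, div_eq_mul_inv (2 * I), div_eq_mul_inv, neg_add, Real.rpow_add hx,
    Real.rpow_neg_one, Real.rpow_add_one two_ne_zero]
  push_cast
  ring

lemma differentiable_limit (K b : ℂ) {c : ℝ} (hc : 0 < c) :
    Differentiable ℂ fun t => K * Complex.exp (-(I * t)) * oneF1 b (c : ℂ) (2 * I * t) := by
  have := differentiable_oneF1 b hc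
  fun_prop

/-- Rate of convergence for `P̃_N` and `Q_N`: for `Re(s) > −1/2` and every
`x₀ > 0` there is a constant `C(x₀,s)` such that for all `N ≥ 1`, `p ∈ {0,1}` and `x > x₀`,
`|P̃_N^{(p)}(x) − P̃^{(p)}(x)| ≤ (1/N) C(x₀,s)/x^{p+Re(s)}` and
`|Q_N^{(p)}(x) − Q^{(p)}(x)| ≤ (1/N) C(x₀,s)/x^{p+1+Re(s)}`. -/
theorem PtildeN_QN_rate_of_convergence (s : ℂ) (hs : -(1 / 2 : ℝ) < s.re)
    (x₀ : ℝ) (hx₀ : 0 < x₀) :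
    ∃ C : ℝ, ∀ N : ℕ, 1 ≤ N → ∀ p : ℕ, p ≤ 1 → ∀ x : ℝ, x₀ < x →
      ‖iteratedDeriv p (PtildeN s N) x - iteratedDeriv p (Ptilde s) x‖ ≤
        (1 / N) * (C / x ^ ((p : ℝ) + s.re)) ∧
      ‖iteratedDeriv p (QN s N) x - iteratedDeriv p (Qfun s) x‖ ≤
        (1 / N) * (C / x ^ ((p : ℝ) + 1 + s.re)) := by
  have hP : (0 : ℝ) < 2 * s.re + 1 := by linarith
  have hQ : (0 : ℝ) < 2 * s.re + 2 := by linarith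
  have hexp := (unifRate_expoN s (x₀⁻¹ + 1)).exp
  obtain ⟨C₁, hC₁, h₁⟩ := UnifRate.exists_iteratedDeriv_bound (f := PtildeN s) hx₀
    (((unifRate_gammaFac _ hs _).mul hexp).mul
      (unifRate_twoF1neg s hP (x₀⁻¹ + 1) (m := id) (fun N => le_rfl) (fun N => N.le_succ)))
    (fun N hN t ht => ((differentiableAt_expoN s hN ht).cexp.const_mul _).mul
      (differentiableAt_twoF1neg_argN _ _ _ hN ht))
    (differentiable_limit _ _ hP)
    (fun N hN x hx => PtildeN_eq s hN hx) (fun x hx => Ptilde_eq s hx)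
  obtain ⟨C₂, hC₂, h₂⟩ := UnifRate.exists_iteratedDeriv_bound (f := QN s) hx₀
    ((((unifRate_gammaFac _ hs _).mul hexp).mul (unifRate_inv_one_sub _)).mul
      (unifRate_twoF1neg (s + 1) hQ (x₀⁻¹ + 1) (m := fun N => N - 1) (fun N => N.sub_le 1)
        (fun N => by omega)))
    (fun N hN t ht => (((differentiableAt_expoN s hN ht).cexp.const_mul _).mul
      (differentiableAt_inv_one_sub hN ht)).mul (differentiableAt_twoF1neg_argN _ _ _ hN ht))
    (by simpa only [mul_one] using differentiable_limit _ _ hQ)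
    (fun N hN x hx => QN_eq s hN hx) (fun x hx => Qfun_eq s hx)
  refine ⟨C₁ + C₂, fun N hN p hp x hx => ⟨(h₁ N hN p hp x hx).trans ?_, ?_⟩⟩
  · have hx0 : 0 < x := hx₀.trans hx
    gcongr
    linarith
  · have hx0 : 0 < x := hx₀.trans hx
    refine (h₂ N hN p hp x hx).trans ?_
    rw [add_assoc]
    gcongr
    linarith
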